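/- Let 𝒯=(V,ℰ) be a leafless, locally finite rooted directed tree, q ≥ 1 a real number, S_{λ,q} the Dirichlet shift on ℓ²(V), and S'_{λ,q} = S_{λ,q}(S_{λ,q}*S_{λ,q})^{-1} its Cauchy dual. Then for every k ∈ ℕ and every v ∈ V, S_{λ,q}^{*k} S_{λ,q}^k e_v = ((n_v+q)_k/(n_v+1)_k)·e_v and (S'_{λ,q})^{*k} (S'_{λ,q})^k e_v = ((n_v+1)_k/(n_v+q)_k)·e_v; that is, each e_v is an eigenvector of S^{*k}S^k for both shifts. -/

import Mathlib

open scoped ENNReal InnerProductSpace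
open ContinuousLinearMap

noncomputable section

/-- A (countably infinite) rooted directed tree. -/
structure DirTree (V : Type) where
  edge : V → V → Prop
  not_self : ∀ v, ¬ edge v v
  no_circuit : ∀ v, ¬ Relation.TransGen edge v v
  connected : ∀ u v : V, Relation.ReflTransGen (fun a b => edge a b ∨ edge b a) u v
  uniq_parent : ∀ {u w v : V}, edge u v → edge w v → u = w
  root : V
  root_no_parent : ∀ u, ¬ edge u root
  root_uniq : ∀ v, (∀ u, ¬ edge u v) → v = root

namespace DirTree

variable {V : Type} (T : DirTree V)

/-- The set of children of a vertex. -/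
def chi (v : V) : Set V := {u | T.edge v u}

/-- Leafless: every vertex has a child. -/
def Leafless : Prop := ∀ v : V, ∃ u, T.edge v u

/-- Locally finite: every vertex has finitely many children. -/
def LocFin : Prop := ∀ v : V, (T.chi v).Finite

/-- The finset of children of a vertex (locally finite case). -/
def chiFin (hT : T.LocFin) (v : V) : Finset V := (hT v).toFinset

/-- Iterated child sets `Chi^⟨n⟩(W)`. -/
def chiIter (T : DirTree V) : ℕ → Set V → Set V
  | 0, W => W
  | n + 1, W => {u | ∃ v ∈ chiIter T n W, T.edge v u}

/-- The depth of a vertex: the unique `n` with `v ∈ Chi^⟨n⟩(root)`. -/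
def depth (v : V) : ℕ := sInf {n | v ∈ T.chiIter n {T.root}}

/-- The parent map (junk value at the root). -/
def par (v : V) : V :=
  letI := Classical.propDecidable (∃ u, T.edge u v)
  if h : ∃ u, T.edge u v then h.choose else v

end DirTree

/-- `ℓ²(V)`. -/
abbrev l2 (V : Type) := lp (fun _ : V => ℂ) 2

/-- The standard orthonormal basis vector `e_v` of `ℓ²(V)`. -/
def evec {V : Type} (v : V) : l2 V :=
  letI := Classical.decEq V
  lp.single 2 v 1

/-- The Pochhammer symbol `(x)_k = x (x+1) ⋯ (x+k-1)`. -/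
def poch (x : ℝ) (k : ℕ) : ℝ := ∏ i ∈ Finset.range k, (x + i)

namespace DirTree

variable {V : Type} (T : DirTree V)

/-- The weight `λ_{u,q}` (for any child `u` of `v`). -/
def wt (hT : T.LocFin) (q : ℝ) (v : V) : ℝ :=
  Real.sqrt (((T.depth v : ℝ) + q) / ((T.depth v : ℝ) + 1)) /
    Real.sqrt ((T.chiFin hT v).card)

/-- `S` is the Dirichlet shift with parameter `q` on `ℓ²(V)`:
`S e_v = ∑_{u ∈ Chi(v)} λ_{u,q} e_u`. -/
def IsDirichletShift (hT : T.LocFin) (q : ℝ) (S : l2 V →L[ℂ] l2 V) : Prop :=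
  ∀ v : V, S (evec v) = ∑ u ∈ T.chiFin hT v, ((T.wt hT q v : ℝ) : ℂ) • evec u

end DirTree

/-- The Cauchy dual `S (S*S)⁻¹` of a left-invertible operator. -/
def cauchyDual {V : Type} (S : l2 V →L[ℂ] l2 V) : l2 V →L[ℂ] l2 V :=
  S * Ring.inverse (ContinuousLinearMap.adjoint S * S)

namespace DirTree

variable {V : Type} (T : DirTree V)

theorem mem_chiFin (hT : T.LocFin) {v u : V} : u ∈ T.chiFin hT v ↔ T.edge v u := by
  simp [chiFin, chi]

theorem mem_chiIter_succ_iff {v u : V} (h : T.edge v u) (n : ℕ) (W : Set V) :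
    u ∈ T.chiIter (n + 1) W ↔ v ∈ T.chiIter n W := by
  refine ⟨?_, fun hv => ⟨v, hv, h⟩⟩
  rintro ⟨w, hw, hwu⟩
  rwa [T.uniq_parent h hwu]

theorem exists_mem_chiIter_root (v : V) : ∃ n, v ∈ T.chiIter n {T.root} := by
  induction T.connected T.root v with
  | refl => exact ⟨0, rfl⟩
  | @tail b c _ hbc ih =>
    obtain ⟨n, hn⟩ := ih
    rcases hbc with h | h
    · exact ⟨n + 1, b, hn, h⟩
    · cases n with
      | zero =>
        obtain rfl : b = T.root := hn
        exact absurd h (T.root_no_parent c)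
      | succ m => exact ⟨m, (T.mem_chiIter_succ_iff h m _).1 hn⟩

theorem mem_chiIter_depth (v : V) : v ∈ T.chiIter (T.depth v) {T.root} :=
  Nat.sInf_mem (T.exists_mem_chiIter_root v)

theorem depth_le {v : V} {n : ℕ} (h : v ∈ T.chiIter n {T.root}) : T.depth v ≤ n :=
  Nat.sInf_le h

theorem depth_child {v u : V} (h : T.edge v u) : T.depth u = T.depth v + 1 := by
  refine le_antisymm (T.depth_le ((T.mem_chiIter_succ_iff h _ _).2 (T.mem_chiIter_depth v))) ?_
  have hu := T.mem_chiIter_depth u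
  cases hd : T.depth u with
  | zero =>
    rw [hd] at hu
    obtain rfl : u = T.root := hu
    exact absurd h (T.root_no_parent v)
  | succ m =>
    rw [hd] at hu
    have := T.depth_le ((T.mem_chiIter_succ_iff h m _).1 hu)
    omega

theorem card_chiFin_pos (hL : T.Leafless) (hT : T.LocFin) (v : V) :
    0 < (T.chiFin hT v).card := by
  obtain ⟨u, hu⟩ := hL v
  exact Finset.card_pos.2 ⟨u, (T.mem_chiFin hT).2 hu⟩

end DirTree

theorem evec_eq_single {V : Type} [DecidableEq V] (v : V) :
    evec v = lp.single (E := fun _ : V => ℂ) 2 v 1 := by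
  rw [evec, Subsingleton.elim (Classical.decEq V)]

theorem inner_evec_left {V : Type} (v : V) (x : l2 V) : ⟪evec v, x⟫_ℂ = x v := by
  classical
  rw [evec_eq_single, lp.inner_single_left]
  simp

theorem evec_apply {V : Type} [DecidableEq V] (v u : V) :
    (evec v : l2 V) u = if u = v then 1 else 0 := by
  rw [evec_eq_single, lp.single_apply, Pi.single_apply]

theorem inner_evec_evec {V : Type} [DecidableEq V] (v u : V) :
    ⟪evec v, evec u⟫_ℂ = if u = v then (1 : ℂ) else 0 := by
  rw [inner_evec_left, evec_apply]
  simp only [eq_comm]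

theorem ext_inner_evec {V : Type} {x y : l2 V} (h : ∀ v, ⟪evec v, x⟫_ℂ = ⟪evec v, y⟫_ℂ) :
    x = y := by
  ext v
  simpa only [inner_evec_left] using h v

namespace DirTree

variable {V : Type} (T : DirTree V)

/-- The adjoint of a weighted shift whose weights are constant on siblings maps `e_u` to a
multiple of the basis vector of the parent of `u`. -/
theorem adjoint_shift_evec (hT : T.LocFin) {w : V → ℝ} {S : l2 V →L[ℂ] l2 V}
    (hS : ∀ v, S (evec v) = ∑ u ∈ T.chiFin hT v, (w v : ℂ) • evec u)
    {v u : V} (h : T.edge v u) : adjoint S (evec u) = (w v : ℂ) • evec v := by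
  classical
  refine ext_inner_evec fun x => ?_
  rw [adjoint_inner_right, hS, sum_inner]
  simp only [inner_smul_left, inner_smul_right, inner_evec_evec, Complex.conj_ofReal, mul_ite,
    mul_one, mul_zero, Finset.sum_ite_eq, mem_chiFin]
  by_cases hx : v = x
  · subst hx; simp [h]
  · rw [if_neg hx, if_neg fun hxu => hx (T.uniq_parent h hxu)]

/-- If the squared weights below `v` sum to `d (depth v)`, then `e_v` is an eigenvector of
`S*ᵏ Sᵏ` with eigenvalue `∏ i < k, d (depth v + i)`. -/
theorem adjoint_pow_mul_pow_evec (hT : T.LocFin) {w : V → ℝ} {d : ℕ → ℝ} {S : l2 V →L[ℂ] l2 V}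
    (hS : ∀ v, S (evec v) = ∑ u ∈ T.chiFin hT v, (w v : ℂ) • evec u)
    (hw : ∀ v, (T.chiFin hT v).card * w v ^ 2 = d (T.depth v)) (k : ℕ) (v : V) :
    (adjoint S ^ k * S ^ k) (evec v)
      = ((∏ i ∈ Finset.range k, d (T.depth v + i) : ℝ) : ℂ) • evec v := by
  induction k generalizing v with
  | zero => simp
  | succ k ih =>
    have hchild : ∀ u ∈ T.chiFin hT v, adjoint S ((adjoint S ^ k * S ^ k) ((w v : ℂ) • evec u))
        = ((w v ^ 2 * ∏ i ∈ Finset.range k, d (T.depth v + (i + 1)) : ℝ) : ℂ) • evec v := by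
      intro u hu
      have he := (T.mem_chiFin hT).1 hu
      rw [map_smul, ih, map_smul, map_smul, T.adjoint_shift_evec hT hS he, T.depth_child he,
        smul_smul, smul_smul]
      congr 1
      simp only [add_assoc, add_comm 1]
      push_cast
      ring
    have hsplit : (adjoint S ^ (k + 1) * S ^ (k + 1)) (evec v)
        = adjoint S ((adjoint S ^ k * S ^ k) (S (evec v))) := by
      rw [pow_succ', pow_succ]
      rfl
    rw [hsplit, hS, map_sum, map_sum, Finset.sum_congr rfl hchild, Finset.sum_const,
      Finset.prod_range_succ', add_zero, ← hw v, ← Nat.cast_smul_eq_nsmul ℂ, smul_smul]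
    congr 1
    push_cast
    ring

theorem card_mul_wt_sq (hL : T.Leafless) (hT : T.LocFin) {q : ℝ} (hq : 0 ≤ q) (v : V) :
    (T.chiFin hT v).card * T.wt hT q v ^ 2 = ((T.depth v : ℝ) + q) / ((T.depth v : ℝ) + 1) := by
  have hc : ((T.chiFin hT v).card : ℝ) ≠ 0 := by
    exact_mod_cast (T.card_chiFin_pos hL hT v).ne'
  rw [wt, div_pow, Real.sq_sqrt (by positivity), Real.sq_sqrt (by positivity)]
  field_simp

end DirTree

theorem prod_div_eq_poch_div (n : ℕ) (a b : ℝ) (k : ℕ) :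
    ∏ i ∈ Finset.range k, (((n + i : ℕ) : ℝ) + a) / (((n + i : ℕ) : ℝ) + b)
      = poch (n + a) k / poch (n + b) k := by
  rw [Finset.prod_div_distrib, poch, poch]
  congr 1 <;> exact Finset.prod_congr rfl fun i _ => by push_cast; ring

/-- A positive operator which is diagonal with entries at least `1` is invertible. -/
theorem isUnit_adjoint_mul_self_of_diagonal {V : Type} {S : l2 V →L[ℂ] l2 V} {d : V → ℝ}
    (hd : ∀ v, 1 ≤ d v) (hS : ∀ v, (adjoint S * S) (evec v) = (d v : ℂ) • evec v) :
    IsUnit (adjoint S * S) := by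
  refine isUnit_of_forall_le_norm_inner_map _ (c := 1) one_pos fun x => ?_
  have hself : adjoint (adjoint S * S) = adjoint S * S := by
    rw [mul_def, adjoint_comp, adjoint_adjoint]
  have hcoord : ∀ v, ((adjoint S * S) x : l2 V) v = d v * x v := by
    intro v
    rw [← inner_evec_left, ← adjoint_inner_left, hself, hS, inner_smul_left, inner_evec_left,
      Complex.conj_ofReal]
  have hAx := (lp.hasSum_inner (𝕜 := ℂ) ((adjoint S * S) x) x).mapL Complex.reCLM
  have hx := (lp.hasSum_inner (𝕜 := ℂ) x x).mapL Complex.reCLM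
  have hle := hasSum_le (fun v => ?_) hx hAx
  · rw [Complex.reCLM_apply, Complex.reCLM_apply, inner_self_eq_norm_sq_to_K] at hle
    have := hle.trans (Complex.re_le_norm _)
    simpa [← Complex.ofReal_pow] using this
  · rw [Complex.reCLM_apply, Complex.reCLM_apply, hcoord, ← smul_eq_mul,
      inner_smul_left, Complex.conj_ofReal, Complex.re_ofReal_mul]
    exact le_mul_of_one_le_left (inner_self_nonneg (𝕜 := ℂ) (x := x v)) (hd v)

theorem cauchyDual_evec {V : Type} {S : l2 V →L[ℂ] l2 V} (hu : IsUnit (adjoint S * S))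
    {v : V} {c : ℝ} (hc : c ≠ 0) (hS : (adjoint S * S) (evec v) = (c : ℂ) • evec v) :
    cauchyDual S (evec v) = ((c⁻¹ : ℝ) : ℂ) • S (evec v) := by
  have hinv : Ring.inverse (adjoint S * S) (evec v) = ((c⁻¹ : ℝ) : ℂ) • evec v := by
    have h : Ring.inverse (adjoint S * S) ((adjoint S * S) (evec v)) = evec v :=
      congrArg (fun A : l2 V →L[ℂ] l2 V => A (evec v)) (Ring.inverse_mul_cancel _ hu)
    rw [hS, map_smul] at h
    rw [eq_comm, Complex.ofReal_inv, inv_smul_eq_iff₀ (Complex.ofReal_ne_zero.2 hc), h]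
  rw [← map_smul, ← hinv]
  rfl

theorem stmt_5 {V : Type} [Countable V] [Infinite V] (T : DirTree V)
    (hL : T.Leafless) (hT : T.LocFin) (q : ℝ) (hq : 1 ≤ q)
    (S : l2 V →L[ℂ] l2 V) (hS : T.IsDirichletShift hT q S) :
    ∀ (k : ℕ) (v : V),
      ((ContinuousLinearMap.adjoint S) ^ k * S ^ k) (evec v)
          = ((poch ((T.depth v : ℝ) + q) k / poch ((T.depth v : ℝ) + 1) k : ℝ) : ℂ) • evec v ∧
      ((ContinuousLinearMap.adjoint (cauchyDual S)) ^ k * cauchyDual S ^ k) (evec v)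
          = ((poch ((T.depth v : ℝ) + 1) k / poch ((T.depth v : ℝ) + q) k : ℝ) : ℂ) • evec v := by
  have hw := T.card_mul_wt_sq hL hT (zero_le_one.trans hq)
  have hmain := T.adjoint_pow_mul_pow_evec hT (d := fun n => ((n : ℝ) + q) / ((n : ℝ) + 1)) hS hw
  have hdiag : ∀ v, (adjoint S * S) (evec v)
      = ((((T.depth v : ℝ) + q) / ((T.depth v : ℝ) + 1) : ℝ) : ℂ) • evec v := fun v => by
    simpa using hmain 1 v
  have hd : ∀ v, 1 ≤ ((T.depth v : ℝ) + q) / ((T.depth v : ℝ) + 1) := fun v => by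
    rw [one_le_div (by positivity)]
    linarith
  have hunit := isUnit_adjoint_mul_self_of_diagonal hd hdiag
  have hdual : ∀ v, cauchyDual S (evec v) = ∑ u ∈ T.chiFin hT v,
      (((((T.depth v : ℝ) + q) / ((T.depth v : ℝ) + 1))⁻¹ * T.wt hT q v : ℝ) : ℂ) • evec u := by
    intro v
    rw [cauchyDual_evec hunit (zero_lt_one.trans_le (hd v)).ne' (hdiag v), hS v, Finset.smul_sum]
    refine Finset.sum_congr rfl fun u _ => ?_
    rw [smul_smul, ← Complex.ofReal_mul]
  have hw' : ∀ v, (T.chiFin hT v).card *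
      ((((T.depth v : ℝ) + q) / ((T.depth v : ℝ) + 1))⁻¹ * T.wt hT q v) ^ 2
      = ((T.depth v : ℝ) + 1) / ((T.depth v : ℝ) + q) := by
    intro v
    have hq0 : (T.depth v : ℝ) + q ≠ 0 := by positivity
    rw [mul_pow, mul_left_comm, hw v]
    field_simp
  intro k v
  rw [← prod_div_eq_poch_div, ← prod_div_eq_poch_div]
  exact ⟨hmain k v, T.adjoint_pow_mul_pow_evec hT
    (d := fun n => ((n : ℝ) + 1) / ((n : ℝ) + q)) hdual hw' k v⟩

end
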